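/- arXiv:2412.16848 — 2 statements merged into one kernel-verified Lean document; each statement's English description precedes it below -/
import Mathlib

section
/- Let S be a nonempty finite type, P : Matrix S S ℝ a row-stochastic matrix (all entries nonnegative and each row sums to 1), and γ ∈ (0,1). Then every entry of R = (1 − γ•P)⁻¹ is nonnegative; consequently, for vectors x, y : S → ℝ with x i ≤ y i for all i, one has (R.mulVec x) i ≤ (R.mulVec y) i for all i, and if x i ≥ 0 for all i then (R.mulVec x) i ≥ 0 for all i. -/
open scoped Matrix

/-- Minimum principle for `1 - γ • P` with `P` row-stochastic. -/
lemma nonneg_of_one_sub_smul_mulVec_nonneg {S : Type*} [Fintype S] [DecidableEq S]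
    {P : Matrix S S ℝ} (hP0 : ∀ i j, 0 ≤ P i j) (hP1 : ∀ i, ∑ j, P i j = 1)
    {γ : ℝ} (hγ0 : 0 ≤ γ) (hγ1 : γ < 1) {v : S → ℝ} (hv : 0 ≤ (1 - γ • P) *ᵥ v) : 0 ≤ v := by
  intro k
  have : Nonempty S := ⟨k⟩
  obtain ⟨i, hi⟩ := Finite.exists_min v
  have hmin : v i ≤ (P *ᵥ v) i := calc
    v i = ∑ j, P i j * v i := by rw [← Finset.sum_mul, hP1, one_mul]
    _ ≤ ∑ j, P i j * v j :=
      Finset.sum_le_sum fun j _ => mul_le_mul_of_nonneg_left (hi j) (hP0 i j)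
  have hvi : 0 ≤ v i - γ * (P *ᵥ v) i := by
    simpa [Matrix.sub_mulVec, Matrix.smul_mulVec] using hv i
  have : 0 ≤ v i := by nlinarith
  exact this.trans (hi k)

lemma isUnit_one_sub_smul_of_rowStochastic {S : Type*} [Fintype S] [DecidableEq S]
    {P : Matrix S S ℝ} (hP0 : ∀ i j, 0 ≤ P i j) (hP1 : ∀ i, ∑ j, P i j = 1)
    {γ : ℝ} (hγ0 : 0 ≤ γ) (hγ1 : γ < 1) : IsUnit (1 - γ • P) := by
  rw [← Matrix.mulVec_injective_iff_isUnit]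
  intro x y (hxy : (1 - γ • P) *ᵥ x = (1 - γ • P) *ᵥ y)
  apply le_antisymm <;> rw [← sub_nonneg] <;>
    exact nonneg_of_one_sub_smul_mulVec_nonneg hP0 hP1 hγ0 hγ1
      (by rw [Matrix.mulVec_sub, hxy, sub_self])

/-- Every entry of the resolvent R = (1 − γ•P)⁻¹ is nonnegative; consequently
R.mulVec is entrywise monotone and preserves entrywise nonnegativity. -/
theorem resolvent_nonneg_monotone
    (S : Type) [Fintype S] [Nonempty S] [DecidableEq S]
    (P : Matrix S S ℝ)
    (hP0 : ∀ i j, 0 ≤ P i j) (hP1 : ∀ i, ∑ j, P i j = 1)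
    (γ : ℝ) (hγ : γ ∈ Set.Ioo (0 : ℝ) 1)
    (R : Matrix S S ℝ) (hR : R = (1 - γ • P)⁻¹) :
    (∀ i j, 0 ≤ R i j) ∧
      (∀ x y : S → ℝ, (∀ i, x i ≤ y i) → ∀ i, R.mulVec x i ≤ R.mulVec y i) ∧
      (∀ x : S → ℝ, (∀ i, 0 ≤ x i) → ∀ i, 0 ≤ R.mulVec x i) := by
  have hunit := isUnit_one_sub_smul_of_rowStochastic hP0 hP1 hγ.1.le hγ.2
  have hnonneg (x : S → ℝ) (hx : ∀ i, 0 ≤ x i) : ∀ i, 0 ≤ R.mulVec x i := by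
    apply nonneg_of_one_sub_smul_mulVec_nonneg hP0 hP1 hγ.1.le hγ.2
    rw [hR, Matrix.mulVec_mulVec,
      Matrix.mul_nonsing_inv _ ((Matrix.isUnit_iff_isUnit_det _).1 hunit), Matrix.one_mulVec]
    exact hx
  refine ⟨fun i j => ?_, fun x y hxy i => ?_, hnonneg⟩
  · have h : (0 : S → ℝ) ≤ Pi.single j 1 := Pi.single_nonneg.2 zero_le_one
    simpa using hnonneg _ h i
  · have h := hnonneg (y - x) (fun k => sub_nonneg.2 (hxy k)) i
    rwa [Matrix.mulVec_sub, Pi.sub_apply, sub_nonneg] at h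
end

section
/- Let S be a nonempty finite type, P : Matrix S S ℝ a row-stochastic matrix (all entries nonnegative and each row sums to 1), and γ ∈ (0,1). Let r, r̂, δ, e : S → ℝ with e i ≥ 0 and |r̂ i − r i| ≤ e i for all i. Suppose Q, Q̂ : S → ℝ satisfy Q = r + γ·P.mulVec Q and Q̂ = r̂ + γ·P.mulVec Q̂ − δ. Set R = (1 − γ•P)⁻¹, h = R.mulVec (−δ), and E = R.mulVec e. Then for all i ∈ S, Q̂ i − Q i ≥ h i − E i. -/
open scoped Matrix

namespace Matrix

variable {S : Type*} [Fintype S] {P : Matrix S S ℝ} {γ : ℝ}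

/-- Minimum principle for discounted stochastic matrices. -/
theorem nonneg_of_discount_mulVec_le [Nonempty S]
    (hP0 : ∀ i j, 0 ≤ P i j) (hP1 : ∀ i, ∑ j, P i j = 1)
    (hγ0 : 0 ≤ γ) (hγ1 : γ < 1) {v : S → ℝ} (hv : ∀ i, γ * (P *ᵥ v) i ≤ v i) (i : S) :
    0 ≤ v i := by
  obtain ⟨k, hk⟩ := Finite.exists_min v
  have hPv : v k ≤ (P *ᵥ v) k := calc
    v k = ∑ j, P k j * v k := by rw [← Finset.sum_mul, hP1, one_mul]
    _ ≤ ∑ j, P k j * v j :=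
      Finset.sum_le_sum fun j _ => mul_le_mul_of_nonneg_left (hk j) (hP0 k j)
  have hvk : γ * v k ≤ v k := (mul_le_mul_of_nonneg_left hPv hγ0).trans (hv k)
  exact (by nlinarith : 0 ≤ v k).trans (hk i)

theorem one_sub_smul_mulVec_apply [DecidableEq S] (v : S → ℝ) (i : S) :
    ((1 - γ • P) *ᵥ v) i = v i - γ * (P *ᵥ v) i := by
  simp [sub_mulVec, smul_mulVec]

theorem isUnit_one_sub_smul [DecidableEq S] [Nonempty S]
    (hP0 : ∀ i j, 0 ≤ P i j) (hP1 : ∀ i, ∑ j, P i j = 1) (hγ0 : 0 ≤ γ) (hγ1 : γ < 1) :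
    IsUnit (1 - γ • P) := by
  have nonneg {v : S → ℝ} (hv : (1 - γ • P) *ᵥ v = 0) (i : S) : 0 ≤ v i := by
    refine nonneg_of_discount_mulVec_le hP0 hP1 hγ0 hγ1 (fun j => ?_) i
    have := congrFun hv j
    rw [one_sub_smul_mulVec_apply, Pi.zero_apply] at this
    linarith
  rw [← mulVec_injective_iff_isUnit]
  intro x y hxy
  have hxy' : (1 - γ • P) *ᵥ x = (1 - γ • P) *ᵥ y := hxy
  funext i
  have h₁ := nonneg (v := x - y) (by rw [mulVec_sub, hxy', sub_self]) i
  have h₂ := nonneg (v := y - x) (by rw [mulVec_sub, hxy', sub_self]) i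
  simp only [Pi.sub_apply] at h₁ h₂
  linarith

/-- The resolvent of a discounted stochastic matrix solves the Bellman equation. -/
theorem resolvent_mulVec_sub [DecidableEq S] [Nonempty S]
    (hP0 : ∀ i j, 0 ≤ P i j) (hP1 : ∀ i, ∑ j, P i j = 1) (hγ0 : 0 ≤ γ) (hγ1 : γ < 1)
    (b : S → ℝ) (i : S) :
    ((1 - γ • P)⁻¹ *ᵥ b) i - γ * (P *ᵥ ((1 - γ • P)⁻¹ *ᵥ b)) i = b i := by
  have hdet := (isUnit_iff_isUnit_det _).mp (isUnit_one_sub_smul hP0 hP1 hγ0 hγ1)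
  rw [← one_sub_smul_mulVec_apply, mulVec_mulVec, mul_nonsing_inv _ hdet, one_mulVec]

end Matrix

/-- Proposition IV.2, lower bound (Equation 6): Q̂ i − Q i ≥ h i − E i. -/
theorem aclql_gap_lower_bound
    (S : Type) [Fintype S] [Nonempty S] [DecidableEq S]
    (P : Matrix S S ℝ)
    (hP0 : ∀ i j, 0 ≤ P i j) (hP1 : ∀ i, ∑ j, P i j = 1)
    (γ : ℝ) (hγ : γ ∈ Set.Ioo (0 : ℝ) 1)
    (r rhat δ e : S → ℝ)
    (he : ∀ i, 0 ≤ e i) (herr : ∀ i, |rhat i - r i| ≤ e i)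
    (Q Qhat : S → ℝ)
    (hQ : ∀ i, Q i = r i + γ * P.mulVec Q i)
    (hQhat : ∀ i, Qhat i = rhat i + γ * P.mulVec Qhat i - δ i)
    (R : Matrix S S ℝ) (hR : R = (1 - γ • P)⁻¹)
    (h E : S → ℝ)
    (hh : h = R.mulVec (fun i => -δ i))
    (hE : E = R.mulVec e) :
    ∀ i, Qhat i - Q i ≥ h i - E i := by
  subst hR hh hE
  obtain ⟨hγ0, hγ1⟩ := hγ
  intro i
  have key := Matrix.nonneg_of_discount_mulVec_le hP0 hP1 hγ0.le hγ1
    (v := Qhat - Q - (1 - γ • P)⁻¹ *ᵥ (fun i => -δ i) + (1 - γ • P)⁻¹ *ᵥ e) (fun j => by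
      have h₁ := Matrix.resolvent_mulVec_sub hP0 hP1 hγ0.le hγ1 (fun i => -δ i) j
      have h₂ := Matrix.resolvent_mulVec_sub hP0 hP1 hγ0.le hγ1 e j
      have h₃ := (abs_le.mp (herr j)).1
      have h₄ := hQ j
      have h₅ := hQhat j
      simp only [Matrix.mulVec_add, Matrix.mulVec_sub, Pi.add_apply, Pi.sub_apply, mul_add,
        mul_sub]
      linarith) i
  simp only [Pi.add_apply, Pi.sub_apply] at key
  linarith
end
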